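/- arXiv:0704.2708 — 4 statements merged into one kernel-verified Lean document; each statement's English description precedes it below -/
import Mathlib

section
/- Fix 0 ≤ k ≤ n. Every subset 𝓐 ⊆ ℤ_+^t such that for all distinct α, ᾱ ∈ 𝓐 neither (ᾱ, Q_{b(ᾱ)}^{(k)}) ⊴ (α, Q_{b(α)}^{(k)}) nor (α, Q_{b(α)}^{(k)}) ⊴ (ᾱ, Q_{b(ᾱ)}^{(k)}) holds (i.e., the corresponding pairs form an antichain with respect to the reduction relation ⊴) is finite. -/
open Matrix Pointwise

/-- Partially extended fiber of order `k`: `Q_b^{(k)} = {z ∈ ℤ^n : Az = b, z_i ≥ 0 for i < k}`. -/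
def Qfib {d n : ℕ} (A : Matrix (Fin d) (Fin n) ℤ) (k : ℕ) (b : Fin d → ℤ) :
    Set (Fin n → ℤ) :=
  {z | A.mulVec z = b ∧ ∀ i : Fin n, (i : ℕ) < k → 0 ≤ z i}

/-- `u ⊑_l v`: componentwise sign-compatible and dominated on the first `l` components. -/
def sqle (n l : ℕ) (u v : Fin n → ℤ) : Prop :=
  ∀ i : Fin n, (i : ℕ) < l → 0 ≤ u i * v i ∧ |u i| ≤ |v i|

/-- `U = V ⊕^{(l)} W`: every `u ∈ U` splits as `u = v + w` with `v ∈ V`, `w ∈ W`,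
`v ⊑_l u` and `w ⊑_l u`. -/
def oplus {n : ℕ} (l : ℕ) (U V W : Set (Fin n → ℤ)) : Prop :=
  ∀ u ∈ U, ∃ v ∈ V, ∃ w ∈ W, sqle n l v u ∧ sqle n l w u ∧ u = v + w

/-- Projection onto the first `l` components (encoded by zeroing the others). -/
def projVec (n l : ℕ) (z : Fin n → ℤ) : Fin n → ℤ :=
  fun i => if (i : ℕ) < l then z i else 0

/-- `π_l(U)`. -/
def projSet {n : ℕ} (l : ℕ) (U : Set (Fin n → ℤ)) : Set (Fin n → ℤ) :=
  projVec n l '' U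

/-- The submonoid of `ℤ^d` generated by `m_1, …, m_t`. -/
def monoidGen {d t : ℕ} (m : Fin t → Fin d → ℤ) : Set (Fin d → ℤ) :=
  {b | ∃ α : Fin t → ℕ, b = ∑ i, (α i : ℤ) • m i}

/-- `Q_b^{(k)}` is atomic w.r.t. `⊕^{(l)}` and `M`. -/
def AtomicFiber {d n : ℕ} (A : Matrix (Fin d) (Fin n) ℤ) (k l : ℕ)
    (M : Set (Fin d → ℤ)) (b : Fin d → ℤ) : Prop :=
  ¬ ∃ b₁ ∈ M, ∃ b₂ ∈ M,
      oplus l (Qfib A k b) (Qfib A k b₁) (Qfib A k b₂) ∧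
      projSet l (Qfib A k b₁) ≠ projSet l (Qfib A k (0 : Fin d → ℤ)) ∧
      projSet l (Qfib A k b₂) ≠ projSet l (Qfib A k (0 : Fin d → ℤ))

/-- `Q_b^{(k)}` is atomic w.r.t. `⊕ = ⊕^{(n)}` and `M` (fiber-inequality form, since
`π_n` is the identity). -/
def AtomicFiberQ {d n : ℕ} (A : Matrix (Fin d) (Fin n) ℤ) (k : ℕ)
    (M : Set (Fin d → ℤ)) (b : Fin d → ℤ) : Prop :=
  ¬ ∃ b₁ ∈ M, ∃ b₂ ∈ M,
      oplus n (Qfib A k b) (Qfib A k b₁) (Qfib A k b₂) ∧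
      Qfib A k b₁ ≠ Qfib A k (0 : Fin d → ℤ) ∧
      Qfib A k b₂ ≠ Qfib A k (0 : Fin d → ℤ)

/-- `S̄^{(l)}`: integer combinations of the last `n - l` columns of `A` that lie in `M`. -/
def SbarSet {d n : ℕ} (A : Matrix (Fin d) (Fin n) ℤ) (l : ℕ)
    (M : Set (Fin d → ℤ)) : Set (Fin d → ℤ) :=
  {s | s ∈ M ∧ ∃ lam : Fin n → ℤ, (∀ i : Fin n, (i : ℕ) < l → lam i = 0) ∧ s = A.mulVec lam}

/-- `U = ⊕^{(l)}_{j} V_j` for a finite family. -/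
def oplusFam {n : ℕ} (l : ℕ) {r : ℕ} (U : Set (Fin n → ℤ))
    (V : Fin r → Set (Fin n → ℤ)) : Prop :=
  ∀ u ∈ U, ∃ v : Fin r → Fin n → ℤ,
    (∀ j, v j ∈ V j) ∧ (∀ j, sqle n l (v j) u) ∧ u = ∑ j, v j

/-- `b(α) = Σ α_i m_i`. -/
def bOf {d t : ℕ} (m : Fin t → Fin d → ℤ) (α : Fin t → ℕ) : Fin d → ℤ :=
  ∑ i, (α i : ℤ) • m i

/-- `(β, Q_{b(β)}^{(k)})` reduces `(α, Q_{b(α)}^{(k)})`. -/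
def Reduces {d n t : ℕ} (A : Matrix (Fin d) (Fin n) ℤ) (m : Fin t → Fin d → ℤ)
    (k : ℕ) (β α : Fin t → ℕ) : Prop :=
  β ≤ α ∧
    oplus n (Qfib A k (bOf m α)) (Qfib A k (bOf m β)) (Qfib A k (bOf m α - bOf m β))

/-- The points of `ℕ^ι` above no element of a finite set form a finite union of boxes
with sides in `ℕ∞`. -/
theorem exists_list_box_iff_forall_not_le {ι : Type*} [Finite ι] (F : Finset (ι → ℕ)) :
    ∃ l : List (ι → ℕ∞), ∀ x : ι → ℕ,
      (∃ a ∈ l, ∀ i, (x i : ℕ∞) < a i) ↔ ∀ f ∈ F, ¬ f ≤ x := by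
  classical
  have := Fintype.ofFinite ι
  induction F using Finset.induction_on with
  | empty => exact ⟨[fun _ => ⊤], fun x => by simp⟩
  | insert f F hf ih =>
    obtain ⟨l, hl⟩ := ih
    refine ⟨l.flatMap fun a => Finset.univ.toList.map fun j =>
      Function.update a j (min (a j) (f j)), fun x => ?_⟩
    simp only [Finset.forall_mem_insert, ← hl x, List.mem_flatMap, List.mem_map,
      Finset.mem_toList, Finset.mem_univ, true_and]
    constructor
    · rintro ⟨_, ⟨a, ha, j, rfl⟩, hx⟩
      have hj := hx j
      rw [Function.update_self, lt_min_iff] at hj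
      refine ⟨fun hfx => (hfx j).not_gt (by exact_mod_cast hj.2), a, ha, fun i => ?_⟩
      by_cases hij : i = j
      · exact hij ▸ hj.1
      · simpa [hij] using hx i
    · rintro ⟨hfx, a, ha, hx⟩
      obtain ⟨j, hj⟩ : ∃ j, x j < f j := by simpa [Pi.le_def] using hfx
      refine ⟨_, ⟨a, ha, j, rfl⟩, fun i => ?_⟩
      by_cases hij : i = j
      · subst hij
        rw [Function.update_self, lt_min_iff]
        exact ⟨hx i, by exact_mod_cast hj⟩
      · simpa [hij] using hx i

/-- The points of `ℕ^ι` above no element of a given set form a finite union of boxes. -/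
theorem exists_list_box_iff_forall_mem_not_le {ι : Type*} [Finite ι] (S : Set (ι → ℕ)) :
    ∃ l : List (ι → ℕ∞), ∀ x : ι → ℕ,
      (∃ a ∈ l, ∀ i, (x i : ℕ∞) < a i) ↔ ∀ f ∈ S, ¬ f ≤ x := by
  have hfin : {x | Minimal (· ∈ S) x}.Finite :=
    WellQuasiOrderedLE.finite_of_isAntichain (setOfPred_minimal_antichain (· ∈ S))
  obtain ⟨l, hl⟩ := exists_list_box_iff_forall_not_le hfin.toFinset
  refine ⟨l, fun x => (hl x).trans ⟨fun h f hf hfx => ?_, fun h f hf => ?_⟩⟩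
  · obtain ⟨g, hgf, hg⟩ := (Set.isPWO_of_wellQuasiOrderedLE S).exists_le_minimal hf
    exact h g (by simpa using hg) (hgf.trans hfx)
  · exact h f (by simpa using ((hfin.mem_toFinset).1 hf).prop)

/-- Every entry of the smaller list is related to some entry of the larger one. -/
theorem List.SublistForall₂.exists_rel_of_mem {α β : Type*} {r : α → β → Prop} {l₁ : List α}
    {l₂ : List β} (h : l₁.SublistForall₂ r l₂) {a : α} (ha : a ∈ l₁) : ∃ b ∈ l₂, r a b := by
  induction h with
  | nil => simp at ha
  | cons hr _ ih => grind
  | cons_right _ ih => grind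

/-- Subsets of `ℕ^ι` are well-quasi-ordered by reverse inclusion of their upper closures
(equivalently, monomial ideals are well-quasi-ordered by reverse inclusion). -/
theorem wellQuasiOrdered_forall_exists_le (ι : Type*) [Finite ι] :
    WellQuasiOrdered fun S T : Set (ι → ℕ) => ∀ x ∈ T, ∃ y ∈ S, y ≤ x := by
  intro S
  choose l hl using fun j => exists_list_box_iff_forall_mem_not_le (S j)
  obtain ⟨p, q, hpq, hsub⟩ :=
    (Set.PartiallyWellOrderedOn.partiallyWellOrderedOn_sublistForall₂ (· ≤ ·)
      (Set.isPWO_of_wellQuasiOrderedLE (Set.univ : Set (ι → ℕ∞)))).exists_lt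
      (f := l) (fun _ _ _ => Set.mem_univ _)
  refine ⟨p, q, hpq, fun x hx => ?_⟩
  by_contra! hnot
  obtain ⟨a, ha, hxa⟩ := (hl p x).2 hnot
  obtain ⟨b, hb, hab⟩ := hsub.exists_rel_of_mem ha
  exact (hl q x).1 ⟨b, hb, fun i => (hxa i).trans_le (hab i)⟩ x hx le_rfl

/-- The positive and negative parts of an integer vector. -/
def posNegParts {n : ℕ} (z : Fin n → ℤ) : Fin n ⊕ Fin n → ℕ :=
  Sum.elim (fun i => (z i).toNat) (fun i => (-z i).toNat)

theorem sqle_and_sqle_sub_of_posNegParts_le {n : ℕ} {u v : Fin n → ℤ}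
    (h : posNegParts u ≤ posNegParts v) : sqle n n u v ∧ sqle n n (v - u) v := by
  have key (i : Fin n) : 0 ≤ u i ∧ u i ≤ v i ∨ v i ≤ u i ∧ u i ≤ 0 := by
    have h₁ : (u i).toNat ≤ (v i).toNat := h (Sum.inl i)
    have h₂ : (-u i).toNat ≤ (-v i).toNat := h (Sum.inr i)
    omega
  refine ⟨fun i _ => ?_, fun i _ => ?_⟩ <;> rcases key i with hi | hi
  · exact ⟨mul_nonneg hi.1 (hi.1.trans hi.2), abs_le_abs_of_nonneg hi.1 hi.2⟩
  · exact ⟨mul_nonneg_of_nonpos_of_nonpos hi.2 (hi.1.trans hi.2),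
      abs_le_abs_of_nonpos hi.2 hi.1⟩
  · simp only [Pi.sub_apply]
    exact ⟨mul_nonneg (by omega) (by omega), by grind⟩
  · simp only [Pi.sub_apply]
    exact ⟨mul_nonneg_of_nonpos_of_nonpos (by omega) (by omega), by grind⟩

theorem sqle.nonneg {n : ℕ} {u v : Fin n → ℤ} (h : sqle n n u v) {i : Fin n}
    (hv : 0 ≤ v i) : 0 ≤ u i := by
  obtain ⟨hmul, habs⟩ := h i i.isLt
  rcases hv.eq_or_lt with hv | hv
  · rw [← hv, abs_zero, abs_nonpos_iff] at habs
    exact habs.ge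
  · exact nonneg_of_mul_nonneg_left hmul hv

theorem oplus_Qfib_of_forall_exists_le {d n k : ℕ} {A : Matrix (Fin d) (Fin n) ℤ}
    {b c : Fin d → ℤ}
    (h : ∀ x ∈ posNegParts '' Qfib A k b, ∃ y ∈ posNegParts '' Qfib A k c, y ≤ x) :
    oplus n (Qfib A k b) (Qfib A k c) (Qfib A k (b - c)) := by
  intro u hu
  obtain ⟨_, ⟨v, hv, rfl⟩, hvu⟩ := h _ ⟨u, hu, rfl⟩
  obtain ⟨hsq, hsq'⟩ := sqle_and_sqle_sub_of_posNegParts_le hvu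
  refine ⟨v, hv, u - v, ⟨?_, fun i hi => hsq'.nonneg (hu.2 i hi)⟩, hsq, hsq', by simp⟩
  rw [Matrix.mulVec_sub, hu.1, hv.1]

theorem wellQuasiOrdered_reduces {d n t : ℕ} (A : Matrix (Fin d) (Fin n) ℤ)
    (m : Fin t → Fin d → ℤ) (k : ℕ) : WellQuasiOrdered (Reduces A m k) := by
  intro f
  obtain ⟨g, hg⟩ := (wellQuasiOrdered_le (α := Fin t → ℕ)).exists_monotone_subseq f
  obtain ⟨p, q, hpq, h⟩ := wellQuasiOrdered_forall_exists_le (Fin n ⊕ Fin n)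
    fun j => posNegParts '' Qfib A k (bOf m (f (g j)))
  exact ⟨g p, g q, g.strictMono hpq, hg p q hpq.le, oplus_Qfib_of_forall_exists_le h⟩

/-- Any antichain with respect to the reduction relation `⊴` is finite. -/
theorem stmt2 (d n t : ℕ) (hn : 0 < n) (A : Matrix (Fin d) (Fin n) ℤ)
    (m : Fin t → Fin d → ℤ) (k : ℕ) (hk : k ≤ n)
    (𝓐 : Set (Fin t → ℕ))
    (hanti : ∀ α ∈ 𝓐, ∀ β ∈ 𝓐, α ≠ β →
      ¬ Reduces A m k β α ∧ ¬ Reduces A m k α β) :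
    𝓐.Finite := by
  exact IsAntichain.finite_of_wellQuasiOrdered
    (fun α hα β hβ hne => (hanti α hα β hβ hne).2) (wellQuasiOrdered_reduces A m k)
end

section
/- Let Λ ⊆ ℤ^d be a subgroup and Λ_A := Λ ∩ {Az : z ∈ ℤ^n}. Let G ⊆ Λ_A be a set with 0 ∈ G such that: (a) every b ∈ Λ_A is a finite sum of elements of G; and (b) for all f, g ∈ G there exist finitely many h_1,…,h_r ∈ G with Q_{f+g} = ⊕_{j=1}^r Q_{h_j}. Then for every b ∈ Λ_A there exist g_1,…,g_m ∈ G with Q_b = ⊕_{j=1}^m Q_{g_j}; in particular, every b̄ ∈ Λ_A with b̄ ≠ 0 such that Q_{b̄} is atomic w.r.t. ⊕ and Λ belongs to G. -/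
open Matrix Pointwise

/-- The `ℓ¹`-norm of an integer vector. -/
def intNorm {n : ℕ} (x : Fin n → ℤ) : ℤ := ∑ i, |x i|

theorem intNorm_nonneg {n : ℕ} (x : Fin n → ℤ) : 0 ≤ intNorm x :=
  Finset.sum_nonneg fun _ _ => abs_nonneg _

theorem Int.sqle_iff_toNat_le {a b : ℤ} :
    (0 ≤ a * b ∧ |a| ≤ |b|) ↔ a.toNat ≤ b.toNat ∧ (-a).toNat ≤ (-b).toNat := by
  rcases le_total 0 a with ha | ha <;> rcases le_total 0 b with hb | hb
  · have := mul_nonneg ha hb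
    rw [abs_of_nonneg ha, abs_of_nonneg hb]; omega
  · rw [abs_of_nonneg ha, abs_of_nonpos hb]
    constructor
    · rintro ⟨h, h'⟩
      have : a = 0 ∨ b = 0 := by
        rw [← mul_eq_zero]; exact le_antisymm (mul_nonpos_of_nonneg_of_nonpos ha hb) h
      omega
    · rintro ⟨h, h'⟩
      have : a = 0 := by omega
      subst this; simpa using hb
  · rw [abs_of_nonpos ha, abs_of_nonneg hb]
    constructor
    · rintro ⟨h, h'⟩
      have : a = 0 ∨ b = 0 := by
        rw [← mul_eq_zero]; exact le_antisymm (mul_nonpos_of_nonpos_of_nonneg ha hb) h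
      omega
    · rintro ⟨h, h'⟩
      have : a = 0 := by omega
      subst this; simpa using hb
  · have := mul_nonneg_of_nonpos_of_nonpos ha hb
    rw [abs_of_nonpos ha, abs_of_nonpos hb]; omega

theorem sqle_iff {n : ℕ} {u v : Fin n → ℤ} :
    sqle n n u v ↔ ∀ i, (u i).toNat ≤ (v i).toNat ∧ (-u i).toNat ≤ (-v i).toNat := by
  simp only [sqle, Fin.is_lt, true_imp_iff, Int.sqle_iff_toNat_le]

theorem sqle_trans {n : ℕ} {u v w : Fin n → ℤ} (huv : sqle n n u v) (hvw : sqle n n v w) :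
    sqle n n u w := by
  rw [sqle_iff] at *
  exact fun i => ⟨(huv i).1.trans (hvw i).1, (huv i).2.trans (hvw i).2⟩

theorem sqle_sub {n : ℕ} {u v : Fin n → ℤ} (h : sqle n n u v) : sqle n n (v - u) v := by
  rw [sqle_iff] at *
  intro i
  have := h i
  rw [Pi.sub_apply]
  omega

/-- Dickson's lemma for the sign-compatible order on integer vectors. -/
theorem exists_finset_sqle {n : ℕ} (S : Set (Fin n → ℤ)) :
    ∃ F : Finset (Fin n → ℤ), ↑F ⊆ S ∧ ∀ u ∈ S, ∃ v ∈ F, sqle n n v u := by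
  let φ : (Fin n → ℤ) → (Fin n → ℕ × ℕ) := fun u i => ((u i).toNat, (-u i).toNat)
  have hφ : ∀ u v, φ u ≤ φ v ↔ sqle n n u v := fun u v => by
    rw [sqle_iff]; rfl
  have hfin : {x | Minimal (· ∈ φ '' S) x}.Finite :=
    WellQuasiOrderedLE.finite_of_isAntichain (setOfPred_minimal_antichain _)
  have hpre : ∀ x ∈ {x | Minimal (· ∈ φ '' S) x}, ∃ u ∈ S, φ u = x := fun x hx => hx.1
  choose! ψ hψS hψ using hpre
  classical
  refine ⟨hfin.toFinset.image ψ, ?_, fun u hu => ?_⟩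
  · intro v hv
    obtain ⟨x, hx, rfl⟩ := Finset.mem_image.mp hv
    exact hψS x (hfin.mem_toFinset.mp hx)
  · obtain ⟨x, hxu, hx⟩ :=
      exists_minimal_le_of_wellFoundedLT (· ∈ φ '' S) (φ u) (Set.mem_image_of_mem φ hu)
    refine ⟨ψ x, Finset.mem_image_of_mem ψ (hfin.mem_toFinset.mpr hx), ?_⟩
    rwa [← hφ, hψ x hx]

/-- Members of a multiset with no coordinatewise sign conflicts are dominated by its sum. -/
theorem sqle_add_of_mul_nonneg {n : ℕ} {x : Fin n → ℤ} {t : Multiset (Fin n → ℤ)}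
    (h : ∀ y ∈ t, ∀ i, 0 ≤ x i * y i) : sqle n n x (x + t.sum) := by
  intro i _
  have hs : 0 ≤ x i * t.sum i := by
    induction t using Multiset.induction_on with
    | empty => simp
    | cons a s ih =>
      rw [Multiset.sum_cons, Pi.add_apply, mul_add]
      exact add_nonneg (h a (Multiset.mem_cons_self a s) i)
        (ih fun y hy => h y (Multiset.mem_cons_of_mem hy))
  refine ⟨?_, sq_le_sq.mp ?_⟩ <;> rw [Pi.add_apply] <;>
    nlinarith [sq_nonneg (x i), sq_nonneg (t.sum i)]

theorem sum_intNorm_of_sqle {n : ℕ} {u : Fin n → ℤ} {t : Multiset (Fin n → ℤ)}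
    (h : ∀ x ∈ t, sqle n n x u) (hu : t.sum = u) : (t.map intNorm).sum = intNorm u := by
  let f : (Fin n → ℤ) →+ ℤ :=
    { toFun := fun x => ∑ i, (u i).sign * x i
      map_zero' := by simp
      map_add' := fun x y => by simp [mul_add, Finset.sum_add_distrib] }
  have hf : ∀ x, sqle n n x u → intNorm x = f x := by
    intro x hx
    rw [sqle_iff] at hx
    refine Finset.sum_congr rfl fun i _ => ?_
    have := hx i
    rcases lt_trichotomy (u i) 0 with hi | hi | hi
    · rw [Int.sign_eq_neg_one_of_neg hi, abs_of_nonpos (by omega)]; ring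
    · have : x i = 0 := by omega
      simp [this]
    · rw [Int.sign_eq_one_of_pos hi, abs_of_nonneg (by omega)]; ring
  rw [Multiset.map_congr rfl fun x hx => hf x (h x hx), ← map_multiset_sum, hu,
    hf u (sqle_iff.mpr fun _ => ⟨le_rfl, le_rfl⟩)]

theorem intNorm_add_le {n : ℕ} (x y : Fin n → ℤ) : intNorm (x + y) ≤ intNorm x + intNorm y := by
  rw [intNorm, intNorm, intNorm, ← Finset.sum_add_distrib]
  exact Finset.sum_le_sum fun i _ => abs_add_le _ _

theorem intNorm_add_lt {n : ℕ} {x y : Fin n → ℤ} {i : Fin n} (h : x i * y i < 0) :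
    intNorm (x + y) < intNorm x + intNorm y := by
  rw [intNorm, intNorm, intNorm, ← Finset.sum_add_distrib]
  refine Finset.sum_lt_sum (fun i _ => abs_add_le _ _) ⟨i, Finset.mem_univ i, ?_⟩
  refine lt_of_le_of_ne (abs_add_le _ _) fun he => ?_
  rcases abs_add_eq_add_abs_iff (x i) (y i) |>.mp he with ⟨h1, h2⟩ | ⟨h1, h2⟩ <;> nlinarith

/-- A multiset whose image under `f` is a list `L` can be indexed compatibly with `L`. -/
theorem Multiset.exists_fin_of_map_eq {α β : Type*} {f : α → β} {L : List β} {vs : Multiset α}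
    (h : vs.map f = L) :
    ∃ v : Fin L.length → α, (∀ j, f (v j) = L.get j) ∧ Finset.univ.val.map v = vs := by
  classical
  induction L generalizing vs with
  | nil =>
    refine ⟨fun j => j.elim0, fun j => j.elim0, ?_⟩
    have : vs = 0 := by simpa using h
    subst this
    rfl
  | cons b L ih =>
    obtain ⟨a, ha, rfl, h'⟩ := (Multiset.map_eq_cons f vs L b).mpr (h.trans (Multiset.cons_coe b L).symm)
    obtain ⟨v, hv, hvs⟩ := ih h'
    refine ⟨Fin.cons a v, fun j => Fin.cases rfl (fun j => hv j) j, ?_⟩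
    rw [← Multiset.cons_erase ha, ← hvs]
    change Finset.univ.val.map (Fin.cons a v : Fin (L.length + 1) → α) = _
    simp [Fin.univ_succ, Function.comp_def]

/-- Every point of `S` is a sign-compatible sum of vectors whose images form the multiset `M`. -/
def SplitsOn {d n : ℕ} (A : Matrix (Fin d) (Fin n) ℤ) (S : Set (Fin n → ℤ))
    (M : Multiset (Fin d → ℤ)) : Prop :=
  ∀ u ∈ S, ∃ vs : Multiset (Fin n → ℤ),
    vs.map A.mulVec = M ∧ vs.sum = u ∧ ∀ x ∈ vs, sqle n n x u

theorem oplusFam.splitsOn {d n r : ℕ} {A : Matrix (Fin d) (Fin n) ℤ} {S : Set (Fin n → ℤ)}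
    {g : Fin r → Fin d → ℤ} (h : oplusFam n S fun j => Qfib A 0 (g j)) :
    SplitsOn A S (Finset.univ.val.map g) := by
  intro u hu
  obtain ⟨v, hv, hvu, rfl⟩ := h u hu
  refine ⟨Finset.univ.val.map v, ?_, rfl, ?_⟩
  · rw [Multiset.map_map]
    exact Multiset.map_congr rfl fun j _ => (hv j).1
  · simpa using hvu

theorem SplitsOn.oplusFam {d n : ℕ} {A : Matrix (Fin d) (Fin n) ℤ} {S : Set (Fin n → ℤ)}
    {L : List (Fin d → ℤ)} (h : SplitsOn A S L) :
    oplusFam n S fun j => Qfib A 0 (L.get j) := by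
  intro u hu
  obtain ⟨vs, hvs, rfl, hle⟩ := h u hu
  obtain ⟨v, hv, rfl⟩ := Multiset.exists_fin_of_map_eq hvs
  exact ⟨v, fun j => ⟨hv j, fun i hi => absurd hi (Nat.not_lt_zero _)⟩,
    fun j => hle _ (Multiset.mem_map_of_mem v (Finset.mem_univ_val j)), rfl⟩

/-- Completion procedure: starting from decompositions of the members of a finite set `F` along a
common multiset, repeatedly replacing two summands in conflict terminates because the total norm
decreases. -/
theorem exists_splitsOn_finset {d n : ℕ} {A : Matrix (Fin d) (Fin n) ℤ} {G : Set (Fin d → ℤ)}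
    (hsum : ∀ f ∈ G, ∀ g ∈ G, ∃ H : Multiset (Fin d → ℤ), (∀ h ∈ H, h ∈ G) ∧
      SplitsOn A {u | A.mulVec u = f + g} H)
    (F : Finset (Fin n → ℤ)) (M : Multiset (Fin d → ℤ)) (hM : ∀ g ∈ M, g ∈ G)
    (D : (Fin n → ℤ) → Multiset (Fin n → ℤ))
    (hD : ∀ u ∈ F, (D u).map A.mulVec = M ∧ (D u).sum = u)
    (k : ℕ) (hk : ∑ u ∈ F, ((D u).map intNorm).sum < k) :
    ∃ N : Multiset (Fin d → ℤ), (∀ g ∈ N, g ∈ G) ∧ SplitsOn A F N := by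
  induction k generalizing M D with
  | zero =>
    refine absurd hk (not_lt.mpr ?_)
    refine Finset.sum_nonneg fun u _ => Multiset.sum_nonneg fun x hx => ?_
    obtain ⟨y, _, rfl⟩ := Multiset.mem_map.mp hx
    exact intNorm_nonneg y
  | succ k ih =>
    by_cases hgood : ∀ u ∈ F, ∀ x ∈ D u, sqle n n x u
    · exact ⟨M, hM, fun u hu => ⟨D u, (hD u hu).1, (hD u hu).2, hgood u hu⟩⟩
    push Not at hgood
    obtain ⟨u, hu, x, hx, hxu⟩ := hgood
    obtain ⟨t, ht⟩ := Multiset.exists_cons_of_mem hx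
    have hconf : ∃ y ∈ t, ∃ i, x i * y i < 0 := by
      by_contra! hcon
      have := sqle_add_of_mul_nonneg hcon
      rw [← Multiset.sum_cons, ← ht, (hD u hu).2] at this
      exact hxu this
    obtain ⟨y, hy, i, hi⟩ := hconf
    obtain ⟨s, rfl⟩ := Multiset.exists_cons_of_mem hy
    have hMeq : M = A.mulVec x ::ₘ A.mulVec y ::ₘ s.map A.mulVec := by
      rw [← (hD u hu).1, ht, Multiset.map_cons, Multiset.map_cons]
    obtain ⟨H, hHG, hH⟩ := hsum (A.mulVec x) (hM _ (by simp [hMeq]))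
      (A.mulVec y) (hM _ (by simp [hMeq]))
    have replace : ∀ p q r, A.mulVec p = A.mulVec x → A.mulVec q = A.mulVec y →
        r.map A.mulVec = s.map A.mulVec → ∃ E : Multiset (Fin n → ℤ),
          E.map A.mulVec = H + s.map A.mulVec ∧ E.sum = (p ::ₘ q ::ₘ r).sum ∧
          (E.map intNorm).sum = intNorm (p + q) + (r.map intNorm).sum := by
      intro p q r hp hq hr
      obtain ⟨vs, h1, h2, h3⟩ := hH (p + q) (by
        rw [Set.mem_ofPred_eq, Matrix.mulVec_add, hp, hq])
      refine ⟨vs + r, ?_, ?_, ?_⟩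
      · rw [Multiset.map_add, h1, hr]
      · rw [Multiset.sum_add, h2, Multiset.sum_cons, Multiset.sum_cons, add_assoc]
      · rw [Multiset.map_add, Multiset.sum_add, sum_intNorm_of_sqle h3 h2]
    have step : ∀ w ∈ F, ∃ E : Multiset (Fin n → ℤ),
        E.map A.mulVec = H + s.map A.mulVec ∧ E.sum = w ∧
        (E.map intNorm).sum ≤ ((D w).map intNorm).sum ∧
        (w = u → (E.map intNorm).sum < ((D w).map intNorm).sum) := by
      intro w hw
      by_cases hwu : w = u
      · subst hwu
        obtain ⟨E, hE1, hE2, hE3⟩ := replace x y s rfl rfl rfl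
        have hlt : (E.map intNorm).sum < ((D w).map intNorm).sum := by
          rw [hE3, ht]
          simp only [Multiset.map_cons, Multiset.sum_cons]
          linarith [intNorm_add_lt hi]
        exact ⟨E, hE1, by rw [hE2, ← ht, (hD w hw).2], hlt.le, fun _ => hlt⟩
      · obtain ⟨hDw, hDs⟩ := hD w hw
        rw [hMeq] at hDw
        obtain ⟨p, hp, hpx, hrest⟩ := (Multiset.map_eq_cons _ _ _ _).mpr hDw
        obtain ⟨q, hq, hqy, hr⟩ := (Multiset.map_eq_cons _ _ _ _).mpr hrest
        have hDeq : D w = p ::ₘ q ::ₘ ((D w).erase p).erase q := by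
          rw [Multiset.cons_erase hq, Multiset.cons_erase hp]
        obtain ⟨E, hE1, hE2, hE3⟩ := replace p q _ hpx hqy hr
        refine ⟨E, hE1, by rw [hE2, ← hDeq, hDs], ?_, fun h => absurd h hwu⟩
        rw [hE3]
        conv_rhs => rw [hDeq]
        simp only [Multiset.map_cons, Multiset.sum_cons]
        linarith [intNorm_add_le p q]
    choose! E hE1 hE2 hE3 hE4 using step
    refine ih (H + s.map A.mulVec) ?_ E (fun w hw => ⟨hE1 w hw, hE2 w hw⟩) ?_
    · intro g hg
      rcases Multiset.mem_add.mp hg with hg | hg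
      · exact hHG g hg
      · exact hM g (by rw [hMeq]; exact Multiset.mem_cons_of_mem (Multiset.mem_cons_of_mem hg))
    · have := Finset.sum_lt_sum hE3 ⟨u, hu, hE4 u hu rfl⟩
      push_cast at hk
      omega

/-- Splitting the points of a fibre that are minimal for sign-compatible domination suffices, up to
an extra summand in the kernel. -/
theorem SplitsOn.cons_zero {d n : ℕ} {A : Matrix (Fin d) (Fin n) ℤ} {b : Fin d → ℤ}
    {F S : Set (Fin n → ℤ)} {N : Multiset (Fin d → ℤ)} (h : SplitsOn A F N)
    (hF : ∀ u ∈ F, A.mulVec u = b) (hS : ∀ u ∈ S, A.mulVec u = b)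
    (hdom : ∀ u ∈ S, ∃ v ∈ F, sqle n n v u) : SplitsOn A S (0 ::ₘ N) := by
  intro u hu
  obtain ⟨v, hv, hvu⟩ := hdom u hu
  obtain ⟨vs, hvs, hsum, hle⟩ := h v hv
  refine ⟨(u - v) ::ₘ vs, ?_, ?_, ?_⟩
  · rw [Multiset.map_cons, hvs, Matrix.mulVec_sub, hS u hu, hF v hv, sub_self]
  · rw [Multiset.sum_cons, hsum, sub_add_cancel]
  · intro x hx
    rcases Multiset.mem_cons.mp hx with rfl | hx
    · exact sqle_sub hvu
    · exact sqle_trans (hle x hx) hvu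

/-- A multiset of vectors in the image of `A` lifts along `A`. -/
theorem exists_multiset_map_mulVec_eq {d n : ℕ} (A : Matrix (Fin d) (Fin n) ℤ)
    (M : Multiset (Fin d → ℤ)) (hM : ∀ g ∈ M, ∃ z, A.mulVec z = g) :
    ∃ vs : Multiset (Fin n → ℤ), vs.map A.mulVec = M := by
  choose! z hz using hM
  refine ⟨M.map z, ?_⟩
  rw [Multiset.map_map]
  exact (Multiset.map_congr rfl hz).trans (Multiset.map_id M)

/-- If `G ⊆ Λ_A` contains `0`, additively generates `Λ_A`, and every `Q_{f+g}` (for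
`f, g ∈ G`) is a finite sign-compatible sum of fibers from `G`, then every `Q_b`
(`b ∈ Λ_A`) is a finite sign-compatible sum of fibers from `G`; in particular every
nonzero `b̄ ∈ Λ_A` with `Q_{b̄}` atomic w.r.t. `⊕` and `Λ` lies in `G`. -/
theorem stmt7 (d n : ℕ) (hn : 0 < n) (A : Matrix (Fin d) (Fin n) ℤ)
    (Λ : AddSubgroup (Fin d → ℤ)) (G : Set (Fin d → ℤ))
    (hGsub : G ⊆ {b | b ∈ Λ ∧ ∃ z : Fin n → ℤ, A.mulVec z = b})
    (hG0 : (0 : Fin d → ℤ) ∈ G)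
    (hgen : ∀ b ∈ {b | b ∈ Λ ∧ ∃ z : Fin n → ℤ, A.mulVec z = b},
      ∃ (r : ℕ) (g : Fin r → Fin d → ℤ), (∀ j, g j ∈ G) ∧ b = ∑ j, g j)
    (hsum : ∀ f ∈ G, ∀ g ∈ G,
      ∃ (r : ℕ) (h : Fin r → Fin d → ℤ), (∀ j, h j ∈ G) ∧
        oplusFam n (Qfib A 0 (f + g)) (fun j => Qfib A 0 (h j))) :
    (∀ b ∈ {b | b ∈ Λ ∧ ∃ z : Fin n → ℤ, A.mulVec z = b},
      ∃ (r : ℕ) (g : Fin r → Fin d → ℤ), (∀ j, g j ∈ G) ∧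
        oplusFam n (Qfib A 0 b) (fun j => Qfib A 0 (g j))) ∧
    (∀ bb ∈ {b | b ∈ Λ ∧ ∃ z : Fin n → ℤ, A.mulVec z = b}, bb ≠ 0 →
      AtomicFiberQ A 0 (Λ : Set (Fin d → ℤ)) bb → bb ∈ G) := by
  have hpart : ∀ b ∈ {b | b ∈ Λ ∧ ∃ z : Fin n → ℤ, A.mulVec z = b},
      ∃ (r : ℕ) (g : Fin r → Fin d → ℤ), (∀ j, g j ∈ G) ∧
        oplusFam n (Qfib A 0 b) (fun j => Qfib A 0 (g j)) := by
    intro b hb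
    obtain ⟨r, g, hgG, hbg⟩ := hgen b hb
    obtain ⟨F, hFS, hF⟩ := exists_finset_sqle (Qfib A 0 b)
    have hM : ∀ x ∈ (0 : Fin d → ℤ) ::ₘ Finset.univ.val.map g, x ∈ G := by
      intro x hx
      rcases Multiset.mem_cons.mp hx with rfl | hx
      · exact hG0
      · obtain ⟨j, _, rfl⟩ := Multiset.mem_map.mp hx
        exact hgG j
    obtain ⟨vs, hvs⟩ := exists_multiset_map_mulVec_eq A (Finset.univ.val.map g)
      fun x hx => (hGsub (hM x (Multiset.mem_cons_of_mem hx))).2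
    have hAvs : A.mulVec vs.sum = b := by
      rw [hbg]
      change A.mulVecLin vs.sum = (Finset.univ.val.map g).sum
      rw [map_multiset_sum, ← hvs]
      rfl
    have hsum' : ∀ f ∈ G, ∀ g ∈ G, ∃ H : Multiset (Fin d → ℤ), (∀ h ∈ H, h ∈ G) ∧
        SplitsOn A {u | A.mulVec u = f + g} H := by
      intro f hf g hg
      obtain ⟨r, h, hh, hfam⟩ := hsum f hf g hg
      refine ⟨_, ?_, fun u hu => hfam.splitsOn u
        ⟨hu, fun i hi => absurd hi (Nat.not_lt_zero _)⟩⟩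
      simpa using hh
    obtain ⟨N, hNG, hN⟩ := exists_splitsOn_finset hsum' F _ hM
      (fun u => (u - vs.sum) ::ₘ vs) (fun u hu => by
        rw [Multiset.map_cons, hvs, Matrix.mulVec_sub, hAvs, (hFS hu).1, sub_self,
          Multiset.sum_cons, sub_add_cancel]
        exact ⟨rfl, rfl⟩) _ (Int.lt_succ_self _ |>.trans_le (Int.self_le_toNat _))
    have hfin := hN.cons_zero (S := Qfib A 0 b) (fun u hu => (hFS hu).1) (fun u hu => hu.1) hF
    obtain ⟨L, hL⟩ := Quot.exists_rep ((0 : Fin d → ℤ) ::ₘ N)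
    change (L : Multiset (Fin d → ℤ)) = _ at hL
    refine ⟨L.length, L.get, fun j => ?_, SplitsOn.oplusFam (by rwa [hL])⟩
    have hj : L.get j ∈ (0 : Fin d → ℤ) ::ₘ N := by
      rw [← hL]
      exact Multiset.mem_coe.mpr (List.get_mem L j)
    rcases Multiset.mem_cons.mp hj with h0 | hj
    · rw [h0]; exact hG0
    · exact hNG _ hj
  refine ⟨hpart, fun b hb hb0 hatom => ?_⟩
  obtain ⟨r, g, hgG, hfam⟩ := hpart b hb
  have hzero : ∀ c : Fin d → ℤ, Qfib A 0 c = Qfib A 0 0 → c = 0 := by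
    intro c hc
    have h0 : (0 : Fin n → ℤ) ∈ Qfib A 0 c := by
      rw [hc]
      exact ⟨Matrix.mulVec_zero A, fun _ _ => le_rfl⟩
    rw [← h0.1, Matrix.mulVec_zero]
  obtain ⟨j, hj⟩ : ∃ j, g j ≠ 0 := by
    by_contra! hall
    obtain ⟨z, hz⟩ := hb.2
    obtain ⟨v, hv, -, hsumv⟩ := hfam z ⟨hz, fun i hi => absurd hi (Nat.not_lt_zero _)⟩
    apply hb0
    rw [← hz, hsumv]
    change A.mulVecLin (∑ j, v j) = 0
    rw [map_sum]
    exact Finset.sum_eq_zero fun j _ => (hv j).1.trans (hall j)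
  by_contra hbG
  refine hatom ⟨g j, (hGsub (hgG j)).1, b - g j, Λ.sub_mem hb.1 (hGsub (hgG j)).1, ?_,
    fun h => hj (hzero _ h), fun h => hbG ?_⟩
  · intro u hu
    obtain ⟨v, hv, hle, -⟩ := hfam u hu
    refine ⟨v j, hv j, u - v j, ⟨?_, fun i hi => absurd hi (Nat.not_lt_zero _)⟩, hle j,
      sqle_sub (hle j), (add_sub_cancel _ _).symm⟩
    rw [Matrix.mulVec_sub, hu.1, (hv j).1]
  · rw [sub_eq_zero.mp (hzero _ h)]
    exact hgG j
end

section
/- Fix 0 ≤ k ≤ n and a subgroup Λ ⊆ ℤ^d. Let b ∈ Λ with Q_b^{(k)} ≠ ∅. If Q_b^{(k)} is atomic w.r.t. ⊕ and Λ, then the extended fiber Q_b = Q_b^{(0)} is atomic w.r.t. ⊕ and Λ. -/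
open Matrix Pointwise

/-- A vector sign-compatible with and dominated by `u` is nonnegative wherever `u` is. -/
theorem nonneg_of_sqle {n : ℕ} {u v : Fin n → ℤ} (h : sqle n n v u) {i : Fin n}
    (hi : 0 ≤ u i) : 0 ≤ v i := by
  obtain ⟨hmul, habs⟩ := h i i.isLt
  rcases hi.eq_or_lt with hzero | hpos
  · rw [← hzero, abs_zero, abs_nonpos_iff] at habs
    exact habs.ge
  · exact nonneg_of_mul_nonneg_left hmul hpos

/-- A decomposition of the extended fiber restricts to one of each partially extended fiber. -/
theorem oplus_Qfib_of_zero {d n : ℕ} {A : Matrix (Fin d) (Fin n) ℤ} {b b₁ b₂ : Fin d → ℤ}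
    (k : ℕ) (h : oplus n (Qfib A 0 b) (Qfib A 0 b₁) (Qfib A 0 b₂)) :
    oplus n (Qfib A k b) (Qfib A k b₁) (Qfib A k b₂) := by
  rintro u ⟨hu, hpos⟩
  obtain ⟨v, hv, w, hw, hvu, hwu, huvw⟩ := h u ⟨hu, fun i hi => absurd hi (Nat.not_lt_zero _)⟩
  exact ⟨v, ⟨hv.1, fun i hi => nonneg_of_sqle hvu (hpos i hi)⟩,
    w, ⟨hw.1, fun i hi => nonneg_of_sqle hwu (hpos i hi)⟩, hvu, hwu, huvw⟩

/-- The right-hand side of a partially extended fiber equal to that of `0` is `0`. -/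
theorem eq_zero_of_Qfib_eq {d n k : ℕ} {A : Matrix (Fin d) (Fin n) ℤ} {b : Fin d → ℤ}
    (h : Qfib A k b = Qfib A k 0) : b = 0 := by
  have hmem : (0 : Fin n → ℤ) ∈ Qfib A k b :=
    h ▸ ⟨A.mulVec_zero, fun _ _ => le_rfl⟩
  exact hmem.1.symm.trans A.mulVec_zero

/-- If the partially extended fiber `Q_b^{(k)}` (nonempty, `b ∈ Λ`) is atomic w.r.t. `⊕`
and the subgroup `Λ`, then so is the extended fiber `Q_b = Q_b^{(0)}`. -/
theorem stmt8 (d n k : ℕ) (hn : 0 < n) (hk : k ≤ n)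
    (A : Matrix (Fin d) (Fin n) ℤ) (Λ : AddSubgroup (Fin d → ℤ))
    (b : Fin d → ℤ) (hb : b ∈ Λ) (hne : (Qfib A k b).Nonempty)
    (hatom : AtomicFiberQ A k (Λ : Set (Fin d → ℤ)) b) :
    AtomicFiberQ A 0 (Λ : Set (Fin d → ℤ)) b := by
  rintro ⟨b₁, hb₁, b₂, hb₂, hsum, hne₁, hne₂⟩
  refine hatom ⟨b₁, hb₁, b₂, hb₂, oplus_Qfib_of_zero k hsum, fun h => hne₁ ?_, fun h => hne₂ ?_⟩
  · rw [eq_zero_of_Qfib_eq h]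
  · rw [eq_zero_of_Qfib_eq h]
end

section
/- Fix 0 ≤ k ≤ l ≤ n. Let F ⊆ M be a set such that for every b ∈ F the fiber Q_b^{(k)} is nonempty and atomic w.r.t. ⊕^{(l)} and M, and such that for all distinct b_i, b_j ∈ F neither b_i ⪯_l b_j nor b_j ⪯_l b_i. Then F is finite. -/
open Matrix Pointwise

/-- The complement of the upper closure of a finite subset of `ℕ^ι` is a finite union of boxes
`{x | x < y}` with (possibly infinite) upper corners `y`. -/
theorem exists_list_boxes_of_finite {ι : Type*} [Finite ι] {s : Set (ι → ℕ)} (hs : s.Finite) :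
    ∃ L : List (ι → WithTop ℕ), ∀ x : ι → ℕ,
      (¬ ∃ a ∈ s, a ≤ x) ↔ ∃ y ∈ L, ∀ i, (x i : WithTop ℕ) < y i := by
  classical
  have := Fintype.ofFinite ι
  induction s, hs using Set.Finite.induction_on with
  | empty => exact ⟨[fun _ => ⊤], fun x => by simp⟩
  | @insert a s _ _ ih =>
    obtain ⟨L, hL⟩ := ih
    refine ⟨L.flatMap fun y => (Finset.univ : Finset ι).toList.map fun i =>
      Function.update y i (min (y i) (a i : WithTop ℕ)), fun x => ?_⟩
    have hsplit : (¬ ∃ b ∈ insert a s, b ≤ x) ↔ (∃ i, x i < a i) ∧ ¬ ∃ b ∈ s, b ≤ x := by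
      simp [Pi.le_def]
    rw [hsplit, hL]
    simp only [List.mem_flatMap, List.mem_map, Finset.mem_toList, Finset.mem_univ, true_and]
    constructor
    · rintro ⟨⟨i, hi⟩, y, hy, hxy⟩
      refine ⟨_, ⟨y, hy, i, rfl⟩, fun j => ?_⟩
      by_cases hj : j = i
      · subst hj
        simpa [hxy j] using hi
      · simpa [hj] using hxy j
    · rintro ⟨_, ⟨y, hy, i, rfl⟩, hxy⟩
      have hi := hxy i
      simp only [Function.update_self, lt_min_iff] at hi
      refine ⟨⟨i, by exact_mod_cast hi.2⟩, y, hy, fun j => ?_⟩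
      by_cases hj : j = i
      · subst hj
        exact hi.1
      · simpa [hj] using hxy j

/-- The complement of the upper closure of a subset of `ℕ^ι` is a finite union of boxes. -/
theorem exists_list_boxes {ι : Type*} [Finite ι] (s : Set (ι → ℕ)) :
    ∃ L : List (ι → WithTop ℕ), ∀ x : ι → ℕ,
      (¬ ∃ a ∈ s, a ≤ x) ↔ ∃ y ∈ L, ∀ i, (x i : WithTop ℕ) < y i := by
  have hfin : {a | Minimal (· ∈ s) a}.Finite :=
    WellQuasiOrderedLE.finite_of_isAntichain (setOfPred_minimal_antichain (· ∈ s))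
  obtain ⟨L, hL⟩ := exists_list_boxes_of_finite hfin
  refine ⟨L, fun x => ?_⟩
  rw [← hL, not_iff_not]
  constructor
  · rintro ⟨a, ha, hax⟩
    obtain ⟨c, hca, hc⟩ := exists_minimal_le_of_wellFoundedLT (· ∈ s) a ha
    exact ⟨c, hc, hca.trans hax⟩
  · rintro ⟨a, ha, hax⟩
    exact ⟨a, ha.prop, hax⟩

theorem List.SublistForall₂.exists_of_mem {α β : Type*} {R : α → β → Prop} {l₁ : List α}
    {l₂ : List β} (h : List.SublistForall₂ R l₁ l₂) {a : α} (ha : a ∈ l₁) :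
    ∃ b ∈ l₂, R a b := by
  induction h with
  | nil => simp at ha
  | cons hr _ ih =>
    rcases List.mem_cons.1 ha with rfl | ha
    · exact ⟨_, List.mem_cons_self, hr⟩
    · obtain ⟨b, hb, hab⟩ := ih ha
      exact ⟨b, List.mem_cons_of_mem _ hb, hab⟩
  | cons_right _ ih =>
    obtain ⟨b, hb, hab⟩ := ih ha
    exact ⟨b, List.mem_cons_of_mem _ hb, hab⟩

/-- **Maclagan's theorem**: the upper sets of `ℕ^ι` are well-quasi-ordered by reverse inclusion. -/
theorem wellQuasiOrdered_upperClosure_superset {ι : Type*} [Finite ι] :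
    WellQuasiOrdered fun s t : Set (ι → ℕ) => ∀ u ∈ t, ∃ v ∈ s, v ≤ u := by
  intro f
  choose L hL using fun p => exists_list_boxes (f p)
  have hpwo := Set.PartiallyWellOrderedOn.partiallyWellOrderedOn_sublistForall₂ (· ≤ ·)
    (Set.isPWO_of_wellQuasiOrderedLE (Set.univ : Set (ι → WithTop ℕ)))
  obtain ⟨p, q, hpq, h⟩ := hpwo fun p => ⟨L p, fun _ _ => Set.mem_univ _⟩
  refine ⟨p, q, hpq, fun u hu => ?_⟩
  by_contra hv
  obtain ⟨y, hy, huy⟩ := (hL p u).1 hv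
  obtain ⟨z, hz, hyz⟩ := h.exists_of_mem hy
  exact (hL q u).2 ⟨z, hz, fun i => (huy i).trans_le (hyz i)⟩ ⟨u, hu, le_rfl⟩

/-- Coordinates in which `≤` implies `⊑_l`: a vector `α` together with the positive and negative
parts of the first `l` components of `u`. -/
def signedCode {n t : ℕ} (l : ℕ) (α : Fin t → ℕ) (u : Fin n → ℤ) :
    Fin t ⊕ (Fin n ⊕ Fin n) → ℕ :=
  Sum.elim α (Sum.elim (fun i => if (i : ℕ) < l then (u i).toNat else 0)
    fun i => if (i : ℕ) < l then (-u i).toNat else 0)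

theorem signedCode_le {n t l : ℕ} {α β : Fin t → ℕ} {u v : Fin n → ℤ}
    (h : signedCode l α u ≤ signedCode l β v) :
    α ≤ β ∧ ∀ i : Fin n, (i : ℕ) < l → (0 ≤ u i ∧ u i ≤ v i) ∨ (u i ≤ 0 ∧ v i ≤ u i) := by
  refine ⟨fun i => h (Sum.inl i), fun i hi => ?_⟩
  have hpos := h (Sum.inr (Sum.inl i))
  have hneg := h (Sum.inr (Sum.inr i))
  simp only [signedCode, Sum.elim_inr, Sum.elim_inl, hi, if_true] at hpos hneg
  omega

theorem sqle_of_between {n l : ℕ} {u v : Fin n → ℤ}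
    (h : ∀ i : Fin n, (i : ℕ) < l → (0 ≤ u i ∧ u i ≤ v i) ∨ (u i ≤ 0 ∧ v i ≤ u i)) :
    sqle n l u v := by
  intro i hi
  rcases h i hi with ⟨h₀, h₁⟩ | ⟨h₀, h₁⟩
  · exact ⟨mul_nonneg h₀ (h₀.trans h₁), abs_le_abs_of_nonneg h₀ h₁⟩
  · exact ⟨mul_nonneg_of_nonpos_of_nonpos h₀ (h₁.trans h₀), abs_le_abs_of_nonpos h₀ h₁⟩

theorem bOf_sub_mem_monoidGen {d t : ℕ} (m : Fin t → Fin d → ℤ) {α β : Fin t → ℕ} (h : α ≤ β) :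
    bOf m β - bOf m α ∈ monoidGen m := by
  refine ⟨β - α, ?_⟩
  simp only [bOf, ← Finset.sum_sub_distrib, ← sub_smul]
  refine Finset.sum_congr rfl fun i _ => ?_
  rw [Pi.sub_apply, Nat.cast_sub (h i)]

theorem mem_SbarSet_of_projSet_eq {d n k l : ℕ} {A : Matrix (Fin d) (Fin n) ℤ}
    {M : Set (Fin d → ℤ)} {b : Fin d → ℤ} (hb : b ∈ M)
    (h : projSet l (Qfib A k b) = projSet l (Qfib A k 0)) : b ∈ SbarSet A l M := by
  have h0 : projVec n l 0 ∈ projSet l (Qfib A k b) := by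
    rw [h]
    exact ⟨0, ⟨A.mulVec_zero, fun _ _ => le_rfl⟩, rfl⟩
  obtain ⟨z, hz, hz0⟩ := h0
  refine ⟨hb, z, fun i hi => ?_, hz.1.symm⟩
  simpa [projVec, hi] using congrFun hz0 i

theorem oplus_Qfib_sub {d n t k l : ℕ} (hkl : k ≤ l) {A : Matrix (Fin d) (Fin n) ℤ}
    {b c : Fin d → ℤ} {α β : Fin t → ℕ}
    (h : ∀ u ∈ signedCode l α '' Qfib A k b, ∃ v ∈ signedCode l β '' Qfib A k c, v ≤ u) :
    oplus l (Qfib A k b) (Qfib A k c) (Qfib A k (b - c)) := by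
  intro u hu
  obtain ⟨_, ⟨v, hv, rfl⟩, hvu⟩ := h _ ⟨u, hu, rfl⟩
  have hbetween := (signedCode_le hvu).2
  refine ⟨v, hv, u - v, ⟨?_, fun i hi => ?_⟩, sqle_of_between hbetween,
    sqle_of_between fun i hi => ?_, (add_sub_cancel v u).symm⟩
  · rw [Matrix.mulVec_sub, hu.1, hv.1]
  · have hvi := hv.2 i hi
    have hui := hu.2 i hi
    have := hbetween i (hi.trans_le hkl)
    rw [Pi.sub_apply]
    omega
  · have := hbetween i hi
    rw [Pi.sub_apply]
    omega

/-- An antichain for `⪯_l` contains only finitely many elements of `S̄^{(l)}`. -/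
theorem finite_inter_SbarSet {d n t l : ℕ} {A : Matrix (Fin d) (Fin n) ℤ}
    {m : Fin t → Fin d → ℤ} {F : Set (Fin d → ℤ)}
    (hanti : ∀ b₁ ∈ F, ∀ b₂ ∈ F, b₁ ≠ b₂ → b₂ - b₁ ∉ SbarSet A l (monoidGen m)) :
    (F ∩ SbarSet A l (monoidGen m)).Finite := by
  by_contra hinf
  let e := Set.Infinite.natEmbedding _ hinf
  choose α hα using fun p => (e p).2.2.1
  obtain ⟨p, q, hpq, hle⟩ := wellQuasiOrdered_le α
  refine hanti _ (e p).2.1 _ (e q).2.1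
    (fun h => hpq.ne (e.injective (Subtype.ext h))) ⟨?_, ?_⟩
  · rw [hα p, hα q]
    exact bOf_sub_mem_monoidGen m hle
  · obtain ⟨lam, hlam, hp⟩ := (e p).2.2.2
    obtain ⟨mu, hmu, hq⟩ := (e q).2.2.2
    refine ⟨mu - lam, fun i hi => ?_, ?_⟩
    · simp [hlam i hi, hmu i hi]
    · rw [Matrix.mulVec_sub, ← hp, ← hq]

/-- A set `F ⊆ M` of right-hand sides of nonempty fibers atomic w.r.t. `⊕^{(l)}` and `M`
which is an antichain w.r.t. `⪯_l` is finite. -/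
theorem stmt11 (d n t k l : ℕ) (hn : 0 < n) (hkl : k ≤ l) (hln : l ≤ n)
    (A : Matrix (Fin d) (Fin n) ℤ) (m : Fin t → Fin d → ℤ)
    (F : Set (Fin d → ℤ)) (hFsub : F ⊆ monoidGen m)
    (hatom : ∀ b ∈ F, (Qfib A k b).Nonempty ∧ AtomicFiber A k l (monoidGen m) b)
    (hanti : ∀ b₁ ∈ F, ∀ b₂ ∈ F, b₁ ≠ b₂ →
      b₂ - b₁ ∉ SbarSet A l (monoidGen m) ∧ b₁ - b₂ ∉ SbarSet A l (monoidGen m)) :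
    F.Finite := by
  by_contra hinf
  have hfin := finite_inter_SbarSet fun b₁ h₁ b₂ h₂ hne => (hanti b₁ h₁ b₂ h₂ hne).1
  have hinf' : (F \ SbarSet A l (monoidGen m)).Infinite := by
    rw [← Set.sdiff_self_inter]
    exact Set.Infinite.sdiff hinf hfin
  let e := hinf'.natEmbedding
  choose α hα using fun p => hFsub (e p).2.1
  obtain ⟨p, q, hpq, h⟩ := wellQuasiOrdered_upperClosure_superset
    fun p => signedCode l (α p) '' Qfib A k (e p : Fin d → ℤ)
  have hle : α p ≤ α q := by
    obtain ⟨u, hu⟩ := (hatom _ (e q).2.1).1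
    obtain ⟨_, ⟨v, -, rfl⟩, hvu⟩ := h _ ⟨u, hu, rfl⟩
    exact (signedCode_le hvu).1
  have hsub : (e q : Fin d → ℤ) - e p ∈ monoidGen m := by
    rw [hα p, hα q]
    exact bOf_sub_mem_monoidGen m hle
  have hne : (e p : Fin d → ℤ) ≠ e q := fun h => hpq.ne (e.injective (Subtype.ext h))
  refine (hatom _ (e q).2.1).2 ⟨e p, hFsub (e p).2.1, _, hsub, oplus_Qfib_sub hkl h,
    fun h => (e p).2.2 (mem_SbarSet_of_projSet_eq (hFsub (e p).2.1) h), fun h => ?_⟩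
  exact (hanti _ (e p).2.1 _ (e q).2.1 hne).1 (mem_SbarSet_of_projSet_eq hsub h)
end
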